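/- For any finite coloring of the nonempty finite subsets of ℕ there exists an infinite block sequence of finite sets whose nonempty finite unions are monochromatic. Precisely: for every r ≥ 1 and every function c from nonempty finite subsets of ℕ to Fin r, there is a sequence (s_n) of nonempty finite subsets of ℕ with max(s_n) < min(s_{n+1}) for all n, such that c(s_{i_1} ∪ s_{i_2} ∪ ⋯ ∪ s_{i_m}) is the same value for all m ≥ 1 and all indices i_1 < i_2 < ⋯ < i_m. -/

import Mathlib

open Hindman

/-- Multiplication of finite subsets of `ℕ` whose value is `s ∪ t` when `s` and `t` are nonempty
and `max s < min t`, and the absorbing element `∅` otherwise. -/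
@[reducible] def blockMul : Mul (Finset ℕ) where
  mul s t := if s.Nonempty ∧ t.Nonempty ∧ ∀ a ∈ s, ∀ b ∈ t, a < b then s ∪ t else ∅

attribute [local instance] blockMul

theorem blockMul_def (s t : Finset ℕ) :
    s * t = if s.Nonempty ∧ t.Nonempty ∧ ∀ a ∈ s, ∀ b ∈ t, a < b then s ∪ t else ∅ := rfl

theorem blockMul_of_lt {s t : Finset ℕ} (hs : s.Nonempty) (ht : t.Nonempty)
    (h : ∀ a ∈ s, ∀ b ∈ t, a < b) : s * t = s ∪ t :=
  if_pos ⟨hs, ht, h⟩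

theorem lt_of_blockMul_nonempty {s t : Finset ℕ} (h : (s * t).Nonempty) :
    s.Nonempty ∧ t.Nonempty ∧ ∀ a ∈ s, ∀ b ∈ t, a < b := by
  by_contra hn
  rw [blockMul_def, if_neg hn] at h
  exact Finset.not_nonempty_empty h

theorem blockMul_eq_union {s t : Finset ℕ} (h : (s * t).Nonempty) : s * t = s ∪ t :=
  if_pos (lt_of_blockMul_nonempty h)

theorem blockMul_nonempty_iff {s t : Finset ℕ} :
    (s * t).Nonempty ↔ s.Nonempty ∧ t.Nonempty ∧ ∀ a ∈ s, ∀ b ∈ t, a < b :=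
  ⟨lt_of_blockMul_nonempty, fun ⟨hs, ht, h⟩ => by
    rw [blockMul_of_lt hs ht h]; exact hs.mono Finset.subset_union_left⟩

theorem blockMul_assoc_nonempty_iff (s t u : Finset ℕ) :
    (s * t * u).Nonempty ↔ (s * (t * u)).Nonempty := by
  constructor
  · intro h
    obtain ⟨hst, hu, hlt⟩ := lt_of_blockMul_nonempty h
    obtain ⟨hs, ht, hlt'⟩ := lt_of_blockMul_nonempty hst
    rw [blockMul_eq_union hst] at hlt
    have htu : (t * u).Nonempty :=
      blockMul_nonempty_iff.2 ⟨ht, hu, fun a ha => hlt a (Finset.mem_union_right _ ha)⟩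
    refine blockMul_nonempty_iff.2 ⟨hs, htu, fun a ha b hb => ?_⟩
    rw [blockMul_eq_union htu, Finset.mem_union] at hb
    exact hb.elim (hlt' a ha b) (hlt a (Finset.mem_union_left _ ha) b)
  · intro h
    obtain ⟨hs, htu, hlt⟩ := lt_of_blockMul_nonempty h
    obtain ⟨ht, hu, hlt'⟩ := lt_of_blockMul_nonempty htu
    rw [blockMul_eq_union htu] at hlt
    have hst : (s * t).Nonempty :=
      blockMul_nonempty_iff.2 ⟨hs, ht, fun a ha b hb => hlt a ha b (Finset.mem_union_left _ hb)⟩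
    refine blockMul_nonempty_iff.2 ⟨hst, hu, fun a ha b hb => ?_⟩
    rw [blockMul_eq_union hst, Finset.mem_union] at ha
    exact ha.elim (fun ha => hlt a ha b (Finset.mem_union_right _ hb)) (fun ha => hlt' a ha b hb)

/-- Finite subsets of `ℕ` form a semigroup under `blockMul`. -/
@[reducible] def blockSemigroup : Semigroup (Finset ℕ) :=
  { blockMul with
    mul_assoc := fun s t u => by
      by_cases h : (s * t * u).Nonempty
      · have h' := (blockMul_assoc_nonempty_iff s t u).1 h
        rw [blockMul_eq_union h, blockMul_eq_union (lt_of_blockMul_nonempty h).1,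
          blockMul_eq_union h', blockMul_eq_union (lt_of_blockMul_nonempty h').2.1,
          Finset.union_assoc]
      · have h' := mt (blockMul_assoc_nonempty_iff s t u).2 h
        rw [Finset.not_nonempty_iff_eq_empty.1 h, Finset.not_nonempty_iff_eq_empty.1 h'] }

attribute [local instance] blockSemigroup

theorem nonempty_and_le_of_mem_FP_singletons {a : Stream' (Finset ℕ)} {m : Finset ℕ}
    (hm : m ∈ FP a) (k : ℕ) (ha : ∀ n, a.get n = {n + k}) :
    m.Nonempty ∧ ∀ x ∈ m, k ≤ x := by
  induction hm generalizing k with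
  | head' a =>
    have h : a.head = {0 + k} := ha 0
    simp [h]
  | tail' a m _ ih =>
    have := ih (k + 1) fun n => by
      rw [Stream'.get_tail, ha, add_right_comm, add_assoc]
    exact ⟨this.1, fun x hx => Nat.le_of_succ_le (this.2 x hx)⟩
  | cons' a m _ ih =>
    obtain ⟨hne, hle⟩ := ih (k + 1) fun n => by
      rw [Stream'.get_tail, ha, add_right_comm, add_assoc]
    have h : a.head = {k} := by simpa using (ha 0 : a.head = {0 + k})
    have hmul : a.head * m = a.head ∪ m :=
      blockMul_of_lt (by simp [h]) hne (by simpa [h] using hle)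
    rw [hmul, h]
    refine ⟨by simp, fun x hx => ?_⟩
    rcases Finset.mem_union.1 hx with hx | hx
    · exact (Finset.mem_singleton.1 hx).ge
    · exact Nat.le_of_succ_le (hle x hx)

theorem biUnion_mem_FP {b : Stream' (Finset ℕ)} (hb : ∀ m ∈ FP b, m.Nonempty)
    (I : Finset ℕ) (hI : I.Nonempty) : I.biUnion b.get ∈ FP (b.drop (I.min' hI)) := by
  induction I using Finset.eraseInduction with | H I ih => _
  have hmin := I.min'_mem hI
  have hdecomp : I.biUnion b.get =
      (b.drop (I.min' hI)).head ∪ (I.erase (I.min' hI)).biUnion b.get := by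
    rw [Stream'.head_drop, ← Finset.biUnion_insert, Finset.insert_erase hmin]
  rw [hdecomp]
  rcases (I.erase (I.min' hI)).eq_empty_or_nonempty with h | h
  · rw [h, Finset.biUnion_empty, Finset.union_empty]
    exact FP.head _
  · have hle : I.min' hI + 1 ≤ (I.erase (I.min' hI)).min' h :=
      Nat.succ_le_of_lt (Finset.min'_lt_of_mem_erase_min' _ _ <| Finset.min'_mem _ _)
    have htail : (I.erase (I.min' hI)).biUnion b.get ∈ FP (b.drop (I.min' hI)).tail := by
      rw [Stream'.tail_eq_drop, Stream'.drop_drop]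
      have := ih _ hmin h
      obtain ⟨d, hd⟩ := Nat.exists_eq_add_of_le hle
      rw [hd, ← Stream'.drop_drop] at this
      exact FP_drop_subset_FP _ _ this
    have hmem := FP.cons _ _ htail
    rwa [blockMul_eq_union (hb _ (FP_drop_subset_FP _ _ hmem))] at hmem

/-- **Hindman's theorem, finite unions variant**: for every finite coloring of the
(nonempty) finite subsets of `ℕ` there is an infinite block sequence
`s : ℕ → Finset ℕ` of nonempty finite sets (with `max (s n) < min (s (n+1))`)
all of whose nonempty finite unions receive the same color. -/
theorem hindman_finite_unions (r : ℕ) (hr : 1 ≤ r) (c : Finset ℕ → Fin r) :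
    ∃ s : ℕ → Finset ℕ,
      (∀ n, (s n).Nonempty) ∧
      (∀ n, ∀ a ∈ s n, ∀ b ∈ s (n + 1), a < b) ∧
      ∃ i : Fin r, ∀ I : Finset ℕ, I.Nonempty → c (I.biUnion s) = i := by
  obtain ⟨_, ⟨i, rfl⟩, b, hb⟩ := FP_partition_regular (fun n => ({n} : Finset ℕ))
    (Set.range fun i : Fin r => {s : Finset ℕ | s.Nonempty ∧ c s = i}) (Set.finite_range _)
    fun m hm => ⟨_, ⟨c m, rfl⟩, (nonempty_and_le_of_mem_FP_singletons hm 0 fun _ => rfl).1, rfl⟩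
  have hne : ∀ m ∈ FP b, m.Nonempty := fun m hm => (hb hm).1
  refine ⟨b.get, fun n => hne _ (FP.singleton b n), fun n => ?_, i, fun I hI => ?_⟩
  · exact (lt_of_blockMul_nonempty (hne _ (FP.mul_two b n (n + 1) n.lt_succ_self))).2.2
  · exact (hb (FP_drop_subset_FP _ _ (biUnion_mem_FP hne I hI))).2
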